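/- Let K be a field containing the real numbers and C a smooth commutative K-algebra. Then the obvious function from the set of (differential) star products on C[[ℏ]] modulo gauge equivalence to the set of non-differential star products on C[[ℏ]] modulo non-differential gauge equivalence is bijective. -/

import Mathlib

open CategoryTheory Opposite AlgebraicGeometry TopologicalSpace Limits TensorProduct

noncomputable section

section DiffOps
variable (K : Type) [CommRing K] (C : Type) [CommRing C] [Algebra K C]

/-- Grothendieck's inductive definition: `D` is a differential operator of order `≤ n`
relative to `K`. -/
def DiffOpLE : ℕ → (C →ₗ[K] C) → Prop
  | 0 => fun D => ∀ c x, D (c * x) = c * D x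
  | n + 1 => fun D => ∀ c : C,
      DiffOpLE n (D ∘ₗ LinearMap.mulLeft K c - LinearMap.mulLeft K c ∘ₗ D)

/-- `D` is a (`K`-linear, finite order) differential operator on `C`. -/
def IsDiffOp (D : C →ₗ[K] C) : Prop := ∃ n, DiffOpLE K C n D

/-- `B` is a bi-differential operator: a differential operator in each argument. -/
def IsBiDiffOp (B : C →ₗ[K] C →ₗ[K] C) : Prop :=
  ∃ n, (∀ g, DiffOpLE K C n (B.flip g)) ∧ (∀ f, DiffOpLE K C n (B f))
end DiffOps

section Statement19
variable (K : Type) [Field K] (C : Type) [CommRing C] [Algebra K C]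

/-- A (possibly non-differential) star product on `C[[ℏ]]`: a `K[[ℏ]]`-bilinear
associative unital multiplication `f ⋆ g = fg + Σ_{k≥1} β_k(f,g) ℏ^k` with normalized
`K`-bilinear coefficients `β_k` (recorded through the `β_k`). -/
structure NDStar where
  β : ℕ → (C →ₗ[K] C →ₗ[K] C)
  β_zero : β 0 = LinearMap.mul K C
  norm_left : ∀ (n : ℕ) (g : C), β (n + 1) 1 g = 0
  norm_right : ∀ (n : ℕ) (f : C), β (n + 1) f 1 = 0
  assoc : ∀ (n : ℕ) (f g h : C),
      ∑ p ∈ Finset.range (n + 1), β p (β (n - p) f g) h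
        = ∑ p ∈ Finset.range (n + 1), β p f (β (n - p) g h)

/-- a star product is differential when its coefficients are bi-differential operators -/
def NDStar.IsDifferential (s : NDStar K C) : Prop := ∀ n, IsBiDiffOp K C (s.β (n + 1))

/-- the conjugation condition `f ⋆′ g = γ⁻¹(γ(f) ⋆ γ(g))`, coefficientwise -/
def AlgConj (s s' : NDStar K C) (γ : ℕ → (C →ₗ[K] C)) : Prop :=
  ∀ (n : ℕ) (f g : C),
    ∑ p ∈ Finset.range (n + 1), γ p (s'.β (n - p) f g)
      = ∑ c ∈ Finset.Nat.antidiagonalTuple 3 n, s.β (c 0) (γ (c 1) f) (γ (c 2) g)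

/-- `γ = 1_C + Σ_{k≥1} γ_k ℏ^k` with each `γ_k` a normalized `K`-linear map -/
def IsNDGauge (γ : ℕ → (C →ₗ[K] C)) : Prop :=
  γ 0 = LinearMap.id ∧ ∀ n : ℕ, γ (n + 1) (1 : C) = 0

/-- non-differential gauge equivalence of (non-differential) star products -/
def NDGaugeRel (s s' : NDStar K C) : Prop := ∃ γ, IsNDGauge K C γ ∧ AlgConj K C s s' γ

/-- (differential) gauge equivalence of differential star products -/
def DGaugeRel (s s' : {s : NDStar K C // s.IsDifferential}) : Prop :=
  ∃ γ, IsNDGauge K C γ ∧ (∀ n, IsDiffOp K C (γ (n + 1))) ∧ AlgConj K C s.1 s'.1 γ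

section DiffOpCalculus
variable {K C}

open LinearMap in
theorem DiffOpLE.zero (n : ℕ) : DiffOpLE K C n 0 := by
  induction n with
  | zero => intro c x; simp
  | succ n ih => intro c; simpa using ih

open LinearMap in
theorem DiffOpLE.add {n : ℕ} {D E : C →ₗ[K] C} (hD : DiffOpLE K C n D) (hE : DiffOpLE K C n E) :
    DiffOpLE K C n (D + E) := by
  induction n generalizing D E with
  | zero => intro c x; simp only [LinearMap.add_apply, hD c x, hE c x, mul_add]
  | succ n ih =>
    intro c
    convert ih (hD c) (hE c) using 1
    rw [add_comp, comp_add]; abel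

open LinearMap in
theorem DiffOpLE.smul {n : ℕ} {D : C →ₗ[K] C} (a : K) (hD : DiffOpLE K C n D) :
    DiffOpLE K C n (a • D) := by
  induction n generalizing D with
  | zero => intro c x; simp only [LinearMap.smul_apply, hD c x, mul_smul_comm]
  | succ n ih =>
    intro c
    convert ih (hD c) using 1
    rw [smul_comp, comp_smul, smul_sub]

variable (K C) in
/-- The `K`-module of differential operators of order `≤ n`. -/
def diffOps (n : ℕ) : Submodule K (C →ₗ[K] C) where
  carrier := {D | DiffOpLE K C n D}
  add_mem' := DiffOpLE.add
  zero_mem' := DiffOpLE.zero n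
  smul_mem' a _ := DiffOpLE.smul a

open LinearMap

theorem mem_diffOps {n : ℕ} {D : C →ₗ[K] C} : D ∈ diffOps K C n ↔ DiffOpLE K C n D := Iff.rfl

theorem mem_diffOps_zero {D : C →ₗ[K] C} :
    D ∈ diffOps K C 0 ↔ ∀ c, D ∘ₗ mulLeft K c - mulLeft K c ∘ₗ D = 0 := by
  simp only [sub_eq_zero, LinearMap.ext_iff]
  exact Iff.rfl

theorem mem_diffOps_succ {n : ℕ} {D : C →ₗ[K] C} :
    D ∈ diffOps K C (n + 1) ↔ ∀ c, D ∘ₗ mulLeft K c - mulLeft K c ∘ₗ D ∈ diffOps K C n :=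
  Iff.rfl

theorem diffOps_le_succ (n : ℕ) : diffOps K C n ≤ diffOps K C (n + 1) := by
  induction n with
  | zero =>
    intro D hD
    rw [mem_diffOps_succ]
    intro c
    rw [mem_diffOps_zero.1 hD c]
    exact zero_mem _
  | succ n ih => exact fun D hD c => ih (hD c)

theorem diffOps_mono : Monotone (diffOps K C) := monotone_nat_of_le_succ diffOps_le_succ

theorem mulLeft_mem_diffOps (n : ℕ) (c : C) : mulLeft K c ∈ diffOps K C n := by
  refine diffOps_mono (Nat.zero_le n) (mem_diffOps_zero.2 fun b => ?_)
  ext x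
  simp [mul_left_comm]

theorem comp_mem_diffOps {m n : ℕ} {D E : C →ₗ[K] C} (hD : D ∈ diffOps K C m)
    (hE : E ∈ diffOps K C n) : D ∘ₗ E ∈ diffOps K C (m + n) := by
  have key (D E : C →ₗ[K] C) (c : C) :
      (D ∘ₗ E) ∘ₗ mulLeft K c - mulLeft K c ∘ₗ (D ∘ₗ E) =
        D ∘ₗ (E ∘ₗ mulLeft K c - mulLeft K c ∘ₗ E) +
          (D ∘ₗ mulLeft K c - mulLeft K c ∘ₗ D) ∘ₗ E := by
    ext x; simp
  induction m generalizing n D E with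
  | zero =>
    induction n generalizing E with
    | zero =>
      refine mem_diffOps_zero.2 fun c => ?_
      rw [key, mem_diffOps_zero.1 hD, mem_diffOps_zero.1 hE]; simp
    | succ n ihn =>
      refine mem_diffOps_succ.2 fun c => ?_
      rw [key, mem_diffOps_zero.1 hD, LinearMap.zero_comp, add_zero]
      exact ihn (hE c)
  | succ m ihm =>
    induction n generalizing E with
    | zero =>
      refine mem_diffOps_succ.2 fun c => ?_
      rw [key, mem_diffOps_zero.1 hE, LinearMap.comp_zero, zero_add]
      exact ihm (hD c) hE
    | succ n ihn =>
      refine mem_diffOps_succ.2 fun c => ?_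
      rw [key]
      refine add_mem (ihn (hE c)) ?_
      have := ihm (hD c) hE
      rwa [← add_assoc, Nat.add_right_comm] at this

theorem flip_mem_diffOps_of_balanced {k M : ℕ} {T : C →ₗ[K] C →ₗ[K] C}
    (hT : ∀ f, T f ∈ diffOps K C k)
    (h : ∀ g x, T.flip x ∘ₗ mulLeft K g - T.flip (g * x) ∈ diffOps K C M) (x : C) :
    T.flip x ∈ diffOps K C (M + k + 1) := by
  induction k generalizing T x with
  | zero =>
    refine mem_diffOps_succ.2 fun g => ?_
    convert h g x using 1
    ext f
    simp [hT f g x]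
  | succ k ih =>
    refine mem_diffOps_succ.2 fun g => ?_
    let T' : C →ₗ[K] C →ₗ[K] C := T.compl₂ (mulLeft K g) - T.compr₂ (mulLeft K g)
    have hT' (y : C) : T'.flip y = T.flip (g * y) - mulLeft K g ∘ₗ T.flip y := by
      ext f; simp [T']
    have h' : T'.flip x ∈ diffOps K C (M + k + 1) := by
      refine ih (fun f => hT f g) (fun a y => ?_) x
      have h2 := comp_mem_diffOps (mulLeft_mem_diffOps 0 g) (h a y)
      rw [zero_add] at h2
      convert sub_mem (h a (g * y)) h2 using 1
      ext f
      simp only [hT', LinearMap.sub_apply, LinearMap.comp_apply, mulLeft_apply, flip_apply,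
        mul_left_comm a g y]
      ring
    have e : T.flip x ∘ₗ mulLeft K g - mulLeft K g ∘ₗ T.flip x =
        T.flip x ∘ₗ mulLeft K g - T.flip (g * x) + T'.flip x := by
      rw [hT']; abel
    rw [e]
    exact add_mem (diffOps_mono (show M ≤ M + k + 1 by omega) (h g x)) h'

/-- A bilinear map which is differential in its second argument, and whose Hochschild coboundary is
differential in its first argument, is differential in its first argument. -/
theorem flip_mem_diffOps_of_coboundary {N M : ℕ} {B : C →ₗ[K] C →ₗ[K] C}
    (hB : ∀ f, B f ∈ diffOps K C N)
    (h : ∀ g x, mulLeft K (B g x) - B.flip x ∘ₗ mulLeft K g + B.flip (g * x)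
      - mulLeft K x ∘ₗ B.flip g ∈ diffOps K C M) (x : C) :
    B.flip x ∈ diffOps K C (M + N + 1) := by
  let T : C →ₗ[K] C →ₗ[K] C := B.compl₂ (mulLeft K x) - B.compr₂ (mulLeft K x)
  have hT (y : C) : T.flip y = B.flip (x * y) - mulLeft K x ∘ₗ B.flip y := by
    ext f; simp [T]
  have hx : T.flip 1 ∈ diffOps K C (M + N + 1) := by
    refine flip_mem_diffOps_of_balanced (fun f => ?_) (fun g y => ?_) 1
    · exact diffOps_le_succ N (hB f) x
    · have h1 := sub_mem (mulLeft_mem_diffOps M (B g (x * y))) (h g (x * y))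
      have h2 := comp_mem_diffOps (mulLeft_mem_diffOps 0 x)
        (sub_mem (mulLeft_mem_diffOps M (B g y)) (h g y))
      rw [zero_add] at h2
      convert sub_mem h1 h2 using 1
      ext f
      simp only [hT, LinearMap.sub_apply, LinearMap.add_apply, LinearMap.comp_apply, mulLeft_apply,
        flip_apply, mul_left_comm g x y]
      ring
  have h1 : B.flip 1 ∈ diffOps K C (M + 1) := by
    refine diffOps_le_succ M ?_
    convert sub_mem (mulLeft_mem_diffOps M (B 1 1)) (h 1 1) using 1
    ext f
    simp
  have := comp_mem_diffOps (mulLeft_mem_diffOps 0 x) h1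
  rw [zero_add] at this
  convert add_mem hx (diffOps_mono (show M + 1 ≤ M + N + 1 by omega) this) using 1
  rw [hT, mul_one]; abel

end DiffOpCalculus

section ProjectiveNeighbourhoods
variable {R A : Type} [CommRing R] [CommRing A] [Algebra R A]

theorem projective_quotient_pow_idealOfVars (σ : Type) (m : ℕ) :
    Module.Projective R (MvPolynomial σ R ⧸ MvPolynomial.idealOfVars σ R ^ m) := by
  let V := MvPolynomial.idealOfVars σ R ^ m
  let τ : MvPolynomial σ R →ₗ[R] MvPolynomial σ R :=
    ∑ k ∈ Finset.range m, MvPolynomial.homogeneousComponent k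
  have hτ (p : MvPolynomial σ R) (d : σ →₀ ℕ) :
      (τ p).coeff d = if d.degree < m then p.coeff d else 0 := by
    simp [τ, LinearMap.sum_apply, MvPolynomial.coeff_sum, MvPolynomial.coeff_homogeneousComponent]
  have hτ' (p : MvPolynomial σ R) : τ p - p ∈ V := by
    refine (MvPolynomial.mem_pow_idealOfVars_iff' m _).2 fun d hd => ?_
    simp [hτ, hd]
  have hV : V.restrictScalars R ≤ LinearMap.ker τ := by
    intro p hp
    ext d
    have := (MvPolynomial.mem_pow_idealOfVars_iff' m p).1 hp d
    rw [hτ]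
    simpa using this
  let s : (MvPolynomial σ R ⧸ V) →ₗ[R] MvPolynomial σ R := (V.restrictScalars R).liftQ τ hV ∘ₗ
    (Submodule.Quotient.restrictScalarsEquiv R V).symm.toLinearMap
  have hs (p : MvPolynomial σ R) : s (Ideal.Quotient.mk V p) = τ p := rfl
  have hsplit : (Ideal.Quotient.mkₐ R V).toLinearMap ∘ₗ s = LinearMap.id := by
    refine LinearMap.ext fun x => ?_
    obtain ⟨p, rfl⟩ := Ideal.Quotient.mk_surjective x
    rw [LinearMap.comp_apply, hs]
    exact Ideal.Quotient.eq.2 (hτ' p)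
  exact Module.Projective.of_split s _ hsplit

/-- The infinitesimal neighbourhoods of a section of a formally smooth algebra are projective. -/
theorem projective_quotient_ker_pow [Algebra.FormallySmooth R A] (ε : A →ₐ[R] R) (m : ℕ) :
    Module.Projective R (A ⧸ RingHom.ker ε ^ m) := by
  rcases m with _ | m
  · have : Subsingleton (A ⧸ RingHom.ker ε ^ 0) :=
      Ideal.Quotient.subsingleton_iff.2 (by simp)
    infer_instance
  set I := RingHom.ker ε with hI
  set V := MvPolynomial.idealOfVars I R
  let a : MvPolynomial I R →ₐ[R] A := MvPolynomial.aeval fun j => (j : A)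
  have hεa (p : MvPolynomial I R) : ε (a p) = MvPolynomial.constantCoeff p := by
    have : ε.comp a = MvPolynomial.aeval 0 := by
      ext j
      simpa [a, -SetLike.coe_mem] using RingHom.mem_ker.1 j.2
    simpa using DFunLike.congr_fun this p
  have hV (p : MvPolynomial I R) : p ∈ V ↔ a p ∈ I := by
    refine Iff.trans ?_ (Eq.congr_left (hεa p)).symm
    have := MvPolynomial.mem_pow_idealOfVars_iff' 1 p
    rw [pow_one] at this
    rw [this]
    simp [MvPolynomial.constantCoeff_eq, Finsupp.degree_eq_zero_iff]
  have hVI : V ≤ I.comap a := fun p hp => (hV p).1 hp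
  have hVIm : V ^ (m + 1) ≤ (I ^ (m + 1)).comap a :=
    (Ideal.pow_right_mono hVI _).trans (Ideal.le_comap_pow _ _)
  have hIm : I ^ (m + 1) ≤ I := Ideal.pow_le_self (by simp)
  have := projective_quotient_pow_idealOfVars (R := R) I (m + 1)
  let g : (MvPolynomial I R ⧸ V ^ (m + 1)) →ₐ[R] A ⧸ I ^ (m + 1) :=
    Ideal.quotientMapₐ (I ^ (m + 1)) a hVIm
  have hg (p : MvPolynomial I R) : g (Ideal.Quotient.mk _ p) = Ideal.Quotient.mk _ (a p) := rfl
  have hgs : Function.Surjective g := by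
    intro x
    obtain ⟨x, rfl⟩ := Ideal.Quotient.mk_surjective x
    have hx : x - algebraMap R A (ε x) ∈ I := by simp [hI, RingHom.mem_ker]
    refine ⟨Ideal.Quotient.mk _ (MvPolynomial.C (ε x) + MvPolynomial.X ⟨_, hx⟩), ?_⟩
    rw [hg]
    simp [a]
  have hlift (p : MvPolynomial I R) (x : A) (hx : x ∈ I)
      (h : g (Ideal.Quotient.mk _ p) = Ideal.Quotient.mk _ x) :
      Ideal.Quotient.mk (V ^ (m + 1)) p ∈ V.map (Ideal.Quotient.mk (V ^ (m + 1))) := by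
    refine Ideal.mem_map_of_mem _ ((hV p).2 ?_)
    rw [hg, Ideal.Quotient.eq] at h
    simpa using add_mem (hIm h) hx
  have hnil : V.map (Ideal.Quotient.mk (V ^ (m + 1))) ^ (m + 1) = ⊥ := by
    rw [← Ideal.map_pow, Ideal.map_quotient_self]
  have hker : IsNilpotent
      (RingHom.ker (g : (MvPolynomial I R ⧸ V ^ (m + 1)) →+* A ⧸ I ^ (m + 1))) := by
    refine ⟨m + 1, le_bot_iff.1 ?_⟩
    rw [← hnil]
    refine Ideal.pow_right_mono (fun y hy => ?_) _
    obtain ⟨p, rfl⟩ := Ideal.Quotient.mk_surjective y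
    exact hlift p 0 (zero_mem _) (by simpa using hy)
  let b := Algebra.FormallySmooth.liftOfSurjective (Ideal.Quotient.mkₐ R (I ^ (m + 1))) g hgs hker
  have hgb (x : A) : g (b x) = Ideal.Quotient.mk _ x :=
    Algebra.FormallySmooth.liftOfSurjective_apply _ g hgs hker x
  have hbI : I ≤ (V.map (Ideal.Quotient.mk (V ^ (m + 1)))).comap b := by
    intro x hx
    obtain ⟨p, hp⟩ := Ideal.Quotient.mk_surjective (b x)
    rw [Ideal.mem_comap, ← hp]
    exact hlift p x hx (by rw [hp, hgb])
  have hb (x : A) (hx : x ∈ I ^ (m + 1)) : b x = 0 := by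
    have := (Ideal.pow_right_mono hbI (m + 1)).trans (Ideal.le_comap_pow _ _) hx
    rwa [hnil] at this
  refine Module.Projective.of_split (Ideal.Quotient.liftₐ _ b hb).toLinearMap g.toLinearMap ?_
  refine LinearMap.ext fun x => ?_
  obtain ⟨p, rfl⟩ := Ideal.Quotient.mk_surjective x
  exact hgb p

/-- Linear maps on a power of the kernel of a section of a formally smooth algebra extend. -/
theorem exists_extend_ker_pow [Algebra.FormallySmooth R A] (ε : A →ₐ[R] R) (m : ℕ)
    {M : Type} [AddCommGroup M] [Module R M]
    (v : ((RingHom.ker ε ^ m).restrictScalars R) →ₗ[R] M) :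
    ∃ w : A →ₗ[R] M, ∀ x : (RingHom.ker ε ^ m).restrictScalars R, w x = v x := by
  have := projective_quotient_ker_pow ε m
  obtain ⟨s, hs⟩ := Module.projective_lifting_property
    (Ideal.Quotient.mkₐ R (RingHom.ker ε ^ m)).toLinearMap LinearMap.id
    (Ideal.Quotient.mkₐ_surjective R _)
  let q := (Ideal.Quotient.mkₐ R (RingHom.ker ε ^ m)).toLinearMap
  have hr (x : A) : ((LinearMap.id : A →ₗ[R] A) - s ∘ₗ q) x ∈
      (RingHom.ker ε ^ m).restrictScalars R := by
    have := LinearMap.congr_fun hs (q x)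
    refine Ideal.Quotient.eq.1 ?_
    exact this.symm
  refine ⟨v ∘ₗ (LinearMap.id - s ∘ₗ q).codRestrict _ hr, fun x => ?_⟩
  have hq : q x = 0 := Ideal.Quotient.eq_zero_iff_mem.2 x.2
  rw [LinearMap.comp_apply]
  congr 1
  ext
  simp [hq]

end ProjectiveNeighbourhoods

section Extension
variable {K C}
open LinearMap

theorem LinearMap.exists_comp_eq_of_surjective {R M N Q : Type} [CommRing R] [AddCommGroup M]
    [AddCommGroup N] [AddCommGroup Q] [Module R M] [Module R N] [Module R Q] (f : M →ₗ[R] N)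
    (hf : Function.Surjective f) (g : M →ₗ[R] Q) (h : ker f ≤ ker g) :
    ∃ k : N →ₗ[R] Q, ∀ x, k (f x) = g x := by
  refine ⟨(ker f).liftQ g h ∘ₗ (f.quotKerEquivOfSurjective hf).symm.toLinearMap, fun x => ?_⟩
  have : (f.quotKerEquivOfSurjective hf).symm (f x) = (ker f).mkQ x := by
    rw [LinearEquiv.symm_apply_eq]; rfl
  simp [this]

theorem liftBaseChange_one_tmul_mul (D : C →ₗ[K] C) (c : C) (x : C ⊗[K] C) :
    D.liftBaseChange C (1 ⊗ₜ c * x) = (D ∘ₗ mulLeft K c).liftBaseChange C x := by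
  induction x with
  | zero => simp
  | add x y hx hy => rw [mul_add, map_add, map_add, hx, hy]
  | tmul a b => simp

theorem liftBaseChange_comp_mulLeft (D : C →ₗ[K] C) (c : C) (x : C ⊗[K] C) :
    (mulLeft K c ∘ₗ D).liftBaseChange C x = c * D.liftBaseChange C x := by
  induction x with
  | zero => simp
  | add x y hx hy => rw [map_add, map_add, hx, hy, mul_add]
  | tmul a b => simp [mul_left_comm]

theorem tmul_one_mul_eq_smul (c : C) (x : C ⊗[K] C) : c ⊗ₜ[K] (1 : C) * x = c • x := by
  rw [Algebra.smul_def]; rfl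

theorem liftBaseChange_sub_mul (D : C →ₗ[K] C) (c : C) (x : C ⊗[K] C) :
    D.liftBaseChange C ((1 ⊗ₜ c - c ⊗ₜ 1) * x) =
      (D ∘ₗ mulLeft K c - mulLeft K c ∘ₗ D).liftBaseChange C x := by
  have h (E F : C →ₗ[K] C) : (E - F).liftBaseChange C = E.liftBaseChange C - F.liftBaseChange C :=
    map_sub (LinearMap.liftBaseChangeEquiv (R := K) (M := C) (N := C) C) E F
  rw [h, LinearMap.sub_apply, sub_mul, map_sub, liftBaseChange_one_tmul_mul,
    liftBaseChange_comp_mulLeft, tmul_one_mul_eq_smul, map_smul, smul_eq_mul]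

theorem liftBaseChange_eq_zero_on_mul_iff (D : C →ₗ[K] C) (J : Ideal (C ⊗[K] C)) :
    (∀ x ∈ KaehlerDifferential.ideal K C * J, D.liftBaseChange C x = 0) ↔
      ∀ c, ∀ y ∈ J, (D ∘ₗ mulLeft K c - mulLeft K c ∘ₗ D).liftBaseChange C y = 0 := by
  constructor
  · intro h c y hy
    rw [← liftBaseChange_sub_mul]
    exact h _ (Ideal.mul_mem_mul (KaehlerDifferential.one_smul_sub_smul_one_mem_ideal K c) hy)
  · intro h x hx
    rw [← KaehlerDifferential.span_range_eq_ideal] at hx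
    refine Submodule.mul_induction_on hx (fun r hr y hy => ?_) fun x y hx hy => ?_
    · induction hr using Submodule.span_induction generalizing y with
      | mem r hr =>
        obtain ⟨c, rfl⟩ := hr
        rw [liftBaseChange_sub_mul]
        exact h c y hy
      | zero => simp
      | add r s _ _ hr hs => rw [add_mul, map_add, hr y hy, hs y hy, add_zero]
      | smul p r _ hr =>
        rw [smul_eq_mul, mul_comm p r, mul_assoc]
        exact hr _ (J.mul_mem_left p hy)
    · rw [map_add, hx, hy, add_zero]

theorem mem_diffOps_iff_liftBaseChange {n : ℕ} {D : C →ₗ[K] C} :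
    D ∈ diffOps K C n ↔
      ∀ x ∈ KaehlerDifferential.ideal K C ^ (n + 1), D.liftBaseChange C x = 0 := by
  rw [pow_succ', liftBaseChange_eq_zero_on_mul_iff]
  induction n generalizing D with
  | zero =>
    rw [mem_diffOps_zero]
    refine forall_congr' fun c => ⟨fun h y _ => ?_, fun h => ?_⟩
    · rw [h]
      exact DFunLike.congr_fun
        (map_zero (LinearMap.liftBaseChangeEquiv (R := K) (M := C) (N := C) C)) y
    · ext b
      simpa using h (1 ⊗ₜ b) (by simp)
  | succ n ih =>
    rw [mem_diffOps_succ]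
    refine forall_congr' fun c => ?_
    rw [ih, pow_succ', liftBaseChange_eq_zero_on_mul_iff]

/-- For a smooth algebra, a bilinear map whose Hochschild coboundary is differential in the last
argument becomes differential in the last argument after subtracting a coboundary. -/
theorem exists_sub_commutator_mem_diffOps [Algebra.Smooth K C] {M : ℕ} (B : C →ₗ[K] C →ₗ[K] C)
    (h : ∀ f g, mulLeft K f ∘ₗ B g - B (f * g) + B f ∘ₗ mulLeft K g ∈ diffOps K C M) :
    ∃ (φ : C →ₗ[K] C) (N : ℕ), ∀ f,
      B f - (φ ∘ₗ mulLeft K f - mulLeft K f ∘ₗ φ) ∈ diffOps K C N := by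
  have : IsNoetherianRing (C ⊗[K] C) :=
    have : IsNoetherianRing C := Algebra.FiniteType.isNoetherianRing K C
    Algebra.FiniteType.isNoetherianRing C _
  let I := KaehlerDifferential.ideal K C
  let ε : C ⊗[K] C →ₐ[C] C := Algebra.TensorProduct.lmul'' K
  let bc := LinearMap.liftBaseChangeEquiv (R := K) (M := C) (N := C) C
  have hbc (D : C →ₗ[K] C) : bc D = D.liftBaseChange C := rfl
  let W : C ⊗[K] C →ₗ[C] C ⊗[K] C →ₗ[C] C :=
    LinearMap.liftBaseChange C ((bc.toLinearMap.restrictScalars K) ∘ₗ B)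
  have hW (a b : C) (y : C ⊗[K] C) : W (a ⊗ₜ b) y = a * (B b).liftBaseChange C y := by
    simp [W, hbc]
  have hW1 (c : C) (x y : C ⊗[K] C) (hy : y ∈ I ^ (M + 1)) :
      W (1 ⊗ₜ c * x) y = W x (1 ⊗ₜ c * y) + ε x * (B c).liftBaseChange C y := by
    induction x with
    | zero => simp
    | add x x' hx hx' =>
      rw [mul_add, map_add, map_add, map_add, LinearMap.add_apply, LinearMap.add_apply, hx, hx']
      ring
    | tmul a b =>
      have := mem_diffOps_iff_liftBaseChange.1 (h b c) y hy
      rw [← hbc, map_add, map_sub, hbc, hbc, hbc, LinearMap.add_apply, LinearMap.sub_apply,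
        liftBaseChange_comp_mulLeft, ← liftBaseChange_one_tmul_mul] at this
      rw [Algebra.TensorProduct.tmul_mul_tmul, one_mul, hW, hW, mul_comm c b]
      have e : ε (a ⊗ₜ b) = a * b := Algebra.TensorProduct.lmul'_apply_tmul a b
      rw [e]
      linear_combination -a * this
  have hWbal (p x y : C ⊗[K] C) (hx : x ∈ I) (hy : y ∈ I ^ (M + 1)) :
      W (p * x) y = W x (p * y) := by
    induction p with
    | zero => simp
    | add p q hp hq => rw [add_mul, add_mul, map_add, map_add, LinearMap.add_apply, hp, hq]
    | tmul a b =>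
      have e : a ⊗ₜ[K] b = a • ((1 : C) ⊗ₜ[K] b) := by simp [TensorProduct.smul_tmul']
      have hx0 : ε x = 0 := hx
      rw [e, smul_mul_assoc, smul_mul_assoc, map_smul, map_smul, LinearMap.smul_apply, hW1 b x y hy,
        hx0, zero_mul, add_zero]
  obtain ⟨d, t, ht⟩ := Submodule.fg_iff_exists_fin_generating_family.1
    (IsNoetherian.noetherian I : I.FG)
  have htI (i : Fin d) : t i ∈ I := ht ▸ Submodule.subset_span ⟨i, rfl⟩
  let L := Fintype.linearCombination (C ⊗[K] C) t
  have hL (y : Fin d → C ⊗[K] C) : L y = ∑ i, y i * t i := by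
    simp [L, Fintype.linearCombination_apply]
  have hLr : range L = I := by rw [← ht]; exact Fintype.range_linearCombination _ _
  let Φ : (Fin d → C ⊗[K] C) →ₗ[C] C := ∑ i, W (t i) ∘ₗ LinearMap.proj i
  have hΦ (z : C ⊗[K] C) (hz : z ∈ I ^ (M + 1)) (r : Fin d → C ⊗[K] C) :
      Φ (z • r) = W (L r) z := by
    have (i : Fin d) : W (t i) (z * r i) = W (r i * t i) z := by
      rw [hWbal _ _ _ (htI i) hz, mul_comm]
    simp [Φ, hL, LinearMap.sum_apply, this]
  obtain ⟨k, hk⟩ := Ideal.exists_pow_inf_eq_pow_smul I (ker L)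
  let m := k + (M + 1)
  let Y : Submodule (C ⊗[K] C) (Fin d → C ⊗[K] C) := I ^ m • ⊤
  have hker (y : Fin d → C ⊗[K] C) (hy : y ∈ Y) (hLy : L y = 0) : Φ y = 0 := by
    have hy' : y ∈ I ^ m • ⊤ ⊓ ker L := ⟨hy, hLy⟩
    rw [hk m (Nat.le_add_right _ _), Nat.add_sub_cancel_left] at hy'
    refine Submodule.smul_induction_on hy' (fun z hz r hr => ?_) fun x y hx hy => ?_
    · rw [hΦ z hz, LinearMap.mem_ker.1 hr.2, map_zero, LinearMap.zero_apply]
    · rw [map_add, hx, hy, add_zero]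
  have hLY : Y.map L = I ^ (m + 1) := by
    rw [Submodule.map_smul'', Submodule.map_top, hLr, smul_eq_mul, pow_succ]
  let L' : Y.restrictScalars C →ₗ[C] (I ^ (m + 1)).restrictScalars C :=
    (L.restrictScalars C).restrict fun y hy => by
      have : L y ∈ I ^ (m + 1) := hLY ▸ Submodule.mem_map_of_mem hy
      exact this
  have hL' : Function.Surjective L' := by
    rintro ⟨x, hx⟩
    have hx' : x ∈ Y.map L := hLY ▸ hx
    obtain ⟨y, hy, rfl⟩ := hx'
    exact ⟨⟨y, hy⟩, rfl⟩
  obtain ⟨v, hv⟩ := LinearMap.exists_comp_eq_of_surjective L' hL'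
    (Φ ∘ₗ (Y.restrictScalars C).subtype) fun y hy => hker y.1 y.2 (congrArg Subtype.val hy)
  obtain ⟨w, hw⟩ := exists_extend_ker_pow ε (m + 1) v
  refine ⟨bc.symm w, m, fun f => mem_diffOps_iff_liftBaseChange.2 fun y hy => ?_⟩
  have hym : y ∈ I ^ m := Ideal.pow_le_pow_right (Nat.le_succ m) hy
  have hyM : y ∈ I ^ (M + 1) := Ideal.pow_le_pow_right (Nat.le_add_left _ _) hym
  rw [← hbc, map_sub, LinearMap.sub_apply, hbc, hbc, ← liftBaseChange_sub_mul, ← hbc (bc.symm w),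
    LinearEquiv.apply_symm_apply]
  have hδ : (1 : C) ⊗ₜ[K] f - f ⊗ₜ 1 ∈ range L :=
    hLr ▸ KaehlerDifferential.one_smul_sub_smul_one_mem_ideal K f
  obtain ⟨r, hr⟩ := hδ
  have hyr : y • r ∈ Y := Submodule.smul_mem_smul hym trivial
  have h1 : w ((1 ⊗ₜ f - f ⊗ₜ 1) * y) = Φ (y • r) := by
    rw [← hr, mul_comm, ← smul_eq_mul, ← map_smul]
    exact (hw (L' ⟨y • r, hyr⟩)).trans (hv ⟨y • r, hyr⟩)
  have h2 := mem_diffOps_iff_liftBaseChange.1 (h 1 1) y hyM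
  have h3 : (mulLeft K 1 ∘ₗ B 1 - B (1 * 1) + B 1 ∘ₗ mulLeft K 1 : C →ₗ[K] C) = B 1 := by
    ext; simp
  rw [h3] at h2
  rw [h1, hΦ y hyM, hr, map_sub, LinearMap.sub_apply, hW, hW, h2]
  ring

end Extension

section FormalSeries
variable {K C}
open Finset.HasAntidiagonal (antidiagonal mem_antidiagonal)

variable (K C) in
/-- Multiplication by `ℏ` on `C[[ℏ]]`. -/
def hbar : (ℕ → C) →ₗ[K] (ℕ → C) where
  toFun x n := Nat.casesOn n 0 x
  map_add' x y := by ext (_ | n) <;> simp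
  map_smul' a x := by ext (_ | n) <;> simp

@[simp] theorem hbar_zero (x : ℕ → C) : hbar K C x 0 = 0 := rfl
@[simp] theorem hbar_succ (x : ℕ → C) (n : ℕ) : hbar K C x (n + 1) = x n := rfl

variable (K C) in
/-- The inclusion of `C` in `C[[ℏ]]`. -/
def constSeries : C →ₗ[K] (ℕ → C) := LinearMap.single K (fun _ => C) 0

@[simp] theorem constSeries_zero (f : C) : constSeries K C f 0 = f := rfl
@[simp] theorem constSeries_succ (f : C) (n : ℕ) : constSeries K C f (n + 1) = 0 := rfl

/-- An `ℏ`-linear endomorphism of `C[[ℏ]]` is determined by its values on `C`. -/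
theorem series_ext {T T' : (ℕ → C) →ₗ[K] (ℕ → C)} (h : ∀ x, T (hbar K C x) = hbar K C (T x))
    (h' : ∀ x, T' (hbar K C x) = hbar K C (T' x))
    (hc : ∀ f, T (constSeries K C f) = T' (constSeries K C f)) : T = T' := by
  have dec (x : ℕ → C) : x = constSeries K C (x 0) + hbar K C (fun n => x (n + 1)) := by
    ext (_ | n) <;> simp
  ext x n
  induction n generalizing x with
  | zero =>
    rw [dec x, map_add, map_add, hc, h, h']
    rfl
  | succ n ih =>
    rw [dec x, map_add, map_add, hc, h, h', Pi.add_apply, Pi.add_apply, hbar_succ, hbar_succ, ih]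

theorem series_ext₂ {T T' : (ℕ → C) →ₗ[K] (ℕ → C) →ₗ[K] (ℕ → C)}
    (hl : ∀ x y, T (hbar K C x) y = hbar K C (T x y))
    (hr : ∀ x y, T x (hbar K C y) = hbar K C (T x y))
    (hl' : ∀ x y, T' (hbar K C x) y = hbar K C (T' x y))
    (hr' : ∀ x y, T' x (hbar K C y) = hbar K C (T' x y))
    (hc : ∀ f g, T (constSeries K C f) (constSeries K C g) =
      T' (constSeries K C f) (constSeries K C g)) : T = T' := by
  ext1 x
  refine series_ext (hr x) (hr' x) fun g => ?_
  have : T.flip (constSeries K C g) = T'.flip (constSeries K C g) :=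
    series_ext (fun x => hl x _) (fun x => hl' x _) fun f => hc f g
  exact LinearMap.congr_fun this x

/-- The action on `C[[ℏ]]` of a formal series of endomorphisms of `C`. -/
def act (γ : ℕ → C →ₗ[K] C) : (ℕ → C) →ₗ[K] (ℕ → C) :=
  LinearMap.pi fun n => ∑ a ∈ antidiagonal n, γ a.1 ∘ₗ LinearMap.proj a.2

theorem act_apply (γ : ℕ → C →ₗ[K] C) (x : ℕ → C) (n : ℕ) :
    act γ x n = ∑ a ∈ antidiagonal n, γ a.1 (x a.2) := by
  simp [act]

@[simp] theorem act_hbar (γ : ℕ → C →ₗ[K] C) (x : ℕ → C) :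
    act γ (hbar K C x) = hbar K C (act γ x) := by
  ext (_ | n)
  · simp [act_apply]
  · simp [act_apply, Finset.Nat.sum_antidiagonal_succ']

@[simp] theorem act_constSeries (γ : ℕ → C →ₗ[K] C) (f : C) :
    act γ (constSeries K C f) = fun n => γ n f := by
  ext (_ | n)
  · simp [act_apply]
  · simp [act_apply, Finset.Nat.sum_antidiagonal_succ']

/-- The `ℏ`-bilinear operation on `C[[ℏ]]` with coefficients `β`. -/
def starMul (β : ℕ → C →ₗ[K] C →ₗ[K] C) : (ℕ → C) →ₗ[K] (ℕ → C) →ₗ[K] (ℕ → C) :=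
  LinearMap.mk₂ K (fun x y n => ∑ a ∈ antidiagonal n, ∑ b ∈ antidiagonal a.2,
      β a.1 (x b.1) (y b.2))
    (fun x x' y => by ext n; simp [Finset.sum_add_distrib])
    (fun a x y => by ext n; simp [Finset.smul_sum])
    (fun x y y' => by ext n; simp [Finset.sum_add_distrib])
    (fun a x y => by ext n; simp [Finset.smul_sum])

theorem starMul_apply (β : ℕ → C →ₗ[K] C →ₗ[K] C) (x y : ℕ → C) (n : ℕ) :
    starMul β x y n = ∑ a ∈ antidiagonal n, ∑ b ∈ antidiagonal a.2,
      β a.1 (x b.1) (y b.2) := rfl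

@[simp] theorem starMul_hbar_left (β : ℕ → C →ₗ[K] C →ₗ[K] C) (x y : ℕ → C) :
    starMul β (hbar K C x) y = hbar K C (starMul β x y) := by
  ext (_ | n)
  · simp [starMul_apply]
  · rw [hbar_succ, starMul_apply, Finset.Nat.sum_antidiagonal_succ']
    simp [starMul_apply, Finset.Nat.sum_antidiagonal_succ]

@[simp] theorem starMul_hbar_right (β : ℕ → C →ₗ[K] C →ₗ[K] C) (x y : ℕ → C) :
    starMul β x (hbar K C y) = hbar K C (starMul β x y) := by
  ext (_ | n)
  · simp [starMul_apply]
  · simp [starMul_apply, Finset.Nat.sum_antidiagonal_succ']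

theorem starMul_constSeries_left (β : ℕ → C →ₗ[K] C →ₗ[K] C) (f : C) (y : ℕ → C) (n : ℕ) :
    starMul β (constSeries K C f) y n = ∑ a ∈ antidiagonal n, β a.1 f (y a.2) := by
  rw [starMul_apply]
  refine Finset.sum_congr rfl fun a _ => ?_
  rcases a with ⟨i, _ | m⟩ <;> simp [Finset.Nat.sum_antidiagonal_succ]

theorem starMul_constSeries_right (β : ℕ → C →ₗ[K] C →ₗ[K] C) (x : ℕ → C) (g : C) (n : ℕ) :
    starMul β x (constSeries K C g) n = ∑ a ∈ antidiagonal n, β a.1 (x a.2) g := by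
  rw [starMul_apply]
  refine Finset.sum_congr rfl fun a _ => ?_
  rcases a with ⟨i, _ | m⟩ <;> simp [Finset.Nat.sum_antidiagonal_succ']

@[simp] theorem starMul_constSeries (β : ℕ → C →ₗ[K] C →ₗ[K] C) (f g : C) :
    starMul β (constSeries K C f) (constSeries K C g) = fun n => β n f g := by
  ext (_ | n)
  · simp [starMul_constSeries_left]
  · simp [starMul_constSeries_left, Finset.Nat.sum_antidiagonal_succ']

theorem sum_antidiagonalTuple_three {M : Type} [AddCommMonoid M] (F : ℕ → ℕ → ℕ → M) (n : ℕ) :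
    ∑ c ∈ Finset.Nat.antidiagonalTuple 3 n, F (c 0) (c 1) (c 2) =
      ∑ a ∈ antidiagonal n, ∑ b ∈ antidiagonal a.2, F a.1 b.1 b.2 := by
  rw [Finset.sum_sigma']
  refine Finset.sum_bij' (fun c _ => ⟨(c 0, c 1 + c 2), (c 1, c 2)⟩)
    (fun a _ => ![a.1.1, a.2.1, a.2.2]) ?_ ?_ ?_ ?_ ?_
  · intro c hc
    rw [Finset.Nat.mem_antidiagonalTuple, Fin.sum_univ_three] at hc
    simp [← hc, add_assoc]
  · rintro ⟨⟨a, b⟩, c, d⟩ h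
    simp only [Finset.mem_sigma, mem_antidiagonal] at h
    rw [Finset.Nat.mem_antidiagonalTuple, Fin.sum_univ_three]
    simp [← h.1, ← h.2, add_assoc]
  · intro c _
    ext i
    fin_cases i <;> rfl
  · rintro ⟨⟨a, b⟩, c, d⟩ h
    simp only [Finset.mem_sigma, mem_antidiagonal] at h
    obtain ⟨_, rfl⟩ := h
    rfl
  · intro c _
    rfl

theorem starMul_assoc (s : NDStar K C) (x y z : ℕ → C) :
    starMul s.β (starMul s.β x y) z = starMul s.β x (starMul s.β y z) := by
  have h (y : ℕ → C) (f h : C) :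
      starMul s.β (starMul s.β (constSeries K C f) y) (constSeries K C h) =
        starMul s.β (constSeries K C f) (starMul s.β y (constSeries K C h)) := by
    refine LinearMap.congr_fun (series_ext
      (T := (starMul s.β).flip (constSeries K C h) ∘ₗ starMul s.β (constSeries K C f))
      (T' := starMul s.β (constSeries K C f) ∘ₗ (starMul s.β).flip (constSeries K C h))
      (by simp) (by simp) fun g => ?_) y
    ext n
    simp only [LinearMap.comp_apply, LinearMap.flip_apply, starMul_constSeries,
      starMul_constSeries_left, starMul_constSeries_right]
    rw [Finset.Nat.sum_antidiagonal_eq_sum_range_succ (fun i j => s.β i (s.β j f g) h),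
      Finset.Nat.sum_antidiagonal_eq_sum_range_succ (fun i j => s.β i f (s.β j g h))]
    exact s.assoc n f g h
  refine LinearMap.congr_fun₂ (series_ext₂
    (T := ((starMul s.β).compr₂ (starMul s.β)).flip y)
    (T' := (starMul s.β).compl₂ (starMul s.β y)) ?_ ?_ ?_ ?_ ?_) x z <;> simp [h]

theorem starMul_one_left (s : NDStar K C) (y : ℕ → C) :
    starMul s.β (constSeries K C 1) y = y := by
  refine LinearMap.congr_fun (series_ext (T' := LinearMap.id) (by simp) (by simp) fun g => ?_) y
  ext (_ | n) <;> simp [s.β_zero, s.norm_left]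

theorem starMul_one_right (s : NDStar K C) (x : ℕ → C) :
    starMul s.β x (constSeries K C 1) = x := by
  refine LinearMap.congr_fun (series_ext (T := (starMul s.β).flip (constSeries K C 1))
    (T' := LinearMap.id) (by simp) (by simp) fun g => ?_) x
  ext (_ | n) <;> simp [s.β_zero, s.norm_right]

/-- A star product on `C[[ℏ]]` from coefficients that satisfy the required identities on series. -/
def NDStar.ofStarMul (β : ℕ → C →ₗ[K] C →ₗ[K] C) (h0 : β 0 = LinearMap.mul K C)
    (hl : ∀ y, starMul β (constSeries K C 1) y = y) (hr : ∀ x, starMul β x (constSeries K C 1) = x)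
    (ha : ∀ x y z, starMul β (starMul β x y) z = starMul β x (starMul β y z)) : NDStar K C where
  β := β
  β_zero := h0
  norm_left n g := by simpa using congr_fun (hl (constSeries K C g)) (n + 1)
  norm_right n f := by simpa using congr_fun (hr (constSeries K C f)) (n + 1)
  assoc n f g h := by
    have := congr_fun (ha (constSeries K C f) (constSeries K C g) (constSeries K C h)) n
    simp only [starMul_constSeries, starMul_constSeries_left, starMul_constSeries_right] at this
    rwa [Finset.Nat.sum_antidiagonal_eq_sum_range_succ (fun i j => β i (β j f g) h),
      Finset.Nat.sum_antidiagonal_eq_sum_range_succ (fun i j => β i f (β j g h))] at this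

theorem algConj_iff_antidiagonal {s s' : NDStar K C} {γ : ℕ → C →ₗ[K] C} :
    AlgConj K C s s' γ ↔ ∀ n f g, ∑ a ∈ antidiagonal n, γ a.1 (s'.β a.2 f g) =
      ∑ a ∈ antidiagonal n, ∑ b ∈ antidiagonal a.2,
        s.β a.1 (γ b.1 f) (γ b.2 g) := by
  refine forall_congr' fun n => forall_congr' fun f => forall_congr' fun g => ?_
  rw [Finset.Nat.sum_antidiagonal_eq_sum_range_succ (fun i j => γ i (s'.β j f g)),
    sum_antidiagonalTuple_three (fun i j k => s.β i (γ j f) (γ k g))]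

theorem algConj_iff {s s' : NDStar K C} {γ : ℕ → C →ₗ[K] C} :
    AlgConj K C s s' γ ↔
      ∀ x y, act γ (starMul s'.β x y) = starMul s.β (act γ x) (act γ y) := by
  rw [algConj_iff_antidiagonal]
  constructor
  · intro h
    refine LinearMap.congr_fun₂ (series_ext₂ (T := (starMul s'.β).compr₂ (act γ))
      (T' := (starMul s.β).compl₁₂ (act γ) (act γ)) (by simp) (by simp) (by simp) (by simp) ?_)
    intro f g
    ext n
    simpa [act_apply, starMul_apply] using h n f g
  · intro h n f g
    simpa [act_apply, starMul_apply] using congr_fun (h (constSeries K C f) (constSeries K C g)) n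

theorem isNDGauge_iff {γ : ℕ → C →ₗ[K] C} :
    IsNDGauge K C γ ↔ γ 0 = LinearMap.id ∧ act γ (constSeries K C 1) = constSeries K C 1 := by
  refine and_congr_right fun h0 => ?_
  rw [act_constSeries]
  constructor
  · intro h
    ext (_ | n)
    · simp [h0]
    · simp [h]
  · intro h n
    simpa using congr_fun h (n + 1)

/-- The composition of two formal series of endomorphisms. -/
def seriesComp (γ δ : ℕ → C →ₗ[K] C) (n : ℕ) : C →ₗ[K] C :=
  ∑ a ∈ antidiagonal n, γ a.1 ∘ₗ δ a.2

theorem act_seriesComp (γ δ : ℕ → C →ₗ[K] C) (x : ℕ → C) :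
    act (seriesComp γ δ) x = act γ (act δ x) := by
  refine LinearMap.congr_fun (series_ext (T' := act γ ∘ₗ act δ) (by simp) (by simp)
    fun f => ?_) x
  rw [LinearMap.comp_apply, act_constSeries, act_constSeries]
  ext n
  simp [act_apply, seriesComp]

theorem IsNDGauge.comp {γ δ : ℕ → C →ₗ[K] C} (hγ : IsNDGauge K C γ) (hδ : IsNDGauge K C δ) :
    IsNDGauge K C (seriesComp γ δ) := by
  rw [isNDGauge_iff] at *
  refine ⟨by simp [seriesComp, hγ.1, hδ.1], ?_⟩
  rw [act_seriesComp, hδ.2, hγ.2]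

theorem AlgConj.trans {s s' s'' : NDStar K C} {γ δ : ℕ → C →ₗ[K] C} (h : AlgConj K C s s' γ)
    (h' : AlgConj K C s' s'' δ) : AlgConj K C s s'' (seriesComp γ δ) := by
  rw [algConj_iff] at *
  intro x y
  simp [act_seriesComp, h, h']

theorem IsNDGauge.exists_inverse {γ : ℕ → C →ₗ[K] C} (hγ : IsNDGauge K C γ) :
    ∃ δ, IsNDGauge K C δ ∧ (∀ x, act γ (act δ x) = x) ∧ ∀ x, act δ (act γ x) = x := by
  let P : PowerSeries (Module.End K C) := PowerSeries.mk γ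
  have hP : PowerSeries.constantCoeff P = ((1 : (Module.End K C)ˣ) : Module.End K C) := by
    simpa [P] using! hγ.1
  let δ : ℕ → C →ₗ[K] C := fun n => PowerSeries.coeff n (P.invOfUnit 1)
  have act_one (ε : ℕ → C →ₗ[K] C)
      (hε : ∀ n, ε n = PowerSeries.coeff n (1 : PowerSeries (Module.End K C)))
      (x : ℕ → C) : act ε x = x := by
    refine LinearMap.congr_fun (series_ext (T' := LinearMap.id) (by simp) (by simp)
      fun f => ?_) x
    ext (_ | n) <;> simp [hε, PowerSeries.coeff_one]
  have h1 (x : ℕ → C) : act γ (act δ x) = x := by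
    rw [← act_seriesComp]
    refine act_one _ (fun n => ?_) x
    rw [← PowerSeries.mul_invOfUnit P 1 hP, PowerSeries.coeff_mul]
    simp [seriesComp, δ, P, Module.End.mul_eq_comp]
  have h2 (x : ℕ → C) : act δ (act γ x) = x := by
    rw [← act_seriesComp]
    refine act_one _ (fun n => ?_) x
    rw [← PowerSeries.invOfUnit_mul P 1 hP, PowerSeries.coeff_mul]
    simp [seriesComp, δ, P, Module.End.mul_eq_comp]
  rw [isNDGauge_iff] at hγ
  refine ⟨δ, isNDGauge_iff.2 ⟨?_, ?_⟩, h1, h2⟩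
  · simp [δ]; rfl
  · rw [← hγ.2, h2, hγ.2]

theorem AlgConj.symm {s s' : NDStar K C} {γ δ : ℕ → C →ₗ[K] C} (h : AlgConj K C s s' γ)
    (h1 : ∀ x, act γ (act δ x) = x) (h2 : ∀ x, act δ (act γ x) = x) : AlgConj K C s' s δ := by
  rw [algConj_iff] at *
  intro x y
  rw [← h2 (starMul s'.β (act δ x) (act δ y)), h, h1, h1]

variable (K C) in
theorem ndGaugeRel_equivalence : Equivalence (NDGaugeRel K C) where
  refl s := by
    let ι : ℕ → C →ₗ[K] C := Pi.single 0 LinearMap.id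
    have hι (x : ℕ → C) : act ι x = x := by
      refine LinearMap.congr_fun (series_ext (T' := LinearMap.id) (by simp) (by simp)
        fun f => ?_) x
      ext (_ | n) <;> simp [ι]
    exact ⟨ι, isNDGauge_iff.2 ⟨by simp [ι], hι _⟩, algConj_iff.2 fun x y => by simp only [hι]⟩
  symm := by
    rintro s s' ⟨γ, hγ, h⟩
    obtain ⟨δ, hδ, h1, h2⟩ := hγ.exists_inverse
    exact ⟨δ, hδ, h.symm h1 h2⟩
  trans := by
    rintro s s' s'' ⟨γ, hγ, h⟩ ⟨δ, hδ, h'⟩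
    exact ⟨seriesComp γ δ, hγ.comp hδ, h.trans h'⟩

/-- A star product can be transported along any gauge. -/
theorem IsNDGauge.exists_algConj {γ : ℕ → C →ₗ[K] C} (hγ : IsNDGauge K C γ) (s : NDStar K C) :
    ∃ s', AlgConj K C s s' γ := by
  obtain ⟨δ, hδ, h1, h2⟩ := hγ.exists_inverse
  rw [isNDGauge_iff] at hγ hδ
  let T := ((starMul s.β).compl₁₂ (act γ) (act γ)).compr₂ (act δ)
  let β : ℕ → C →ₗ[K] C →ₗ[K] C := fun n =>
    (T.compl₁₂ (constSeries K C) (constSeries K C)).compr₂ (LinearMap.proj n)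
  have hβ (x y : ℕ → C) : starMul β x y = act δ (starMul s.β (act γ x) (act γ y)) := by
    refine LinearMap.congr_fun₂ (series_ext₂ (T' := T) (by simp) (by simp) (by simp [T])
      (by simp [T]) ?_) x y
    intro f g
    ext n
    simp [β]
  refine ⟨NDStar.ofStarMul β ?_ ?_ ?_ ?_, ?_⟩
  · ext f g
    simp [β, T, act_apply, starMul_apply, hγ.1, hδ.1, s.β_zero]
  · intro y
    rw [hβ, hγ.2, starMul_one_left, h2]
  · intro x
    rw [hβ, hγ.2, starMul_one_right, h2]
  · intro x y z
    simp only [hβ, h1, starMul_assoc]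
  · refine algConj_iff.2 fun x y => ?_
    change act γ (starMul β x y) = _
    rw [hβ, h1]

theorem hbar_pow_add (m k : ℕ) (x : ℕ → C) : (hbar K C ^ m) x (m + k) = x k := by
  induction m with
  | zero => simp
  | succ m ih =>
    rw [pow_succ', Module.End.mul_apply, Nat.add_right_comm, hbar_succ, ih]

theorem hbar_pow_of_lt {m k : ℕ} (h : k < m) (x : ℕ → C) : (hbar K C ^ m) x k = 0 := by
  induction m generalizing k with
  | zero => omega
  | succ m ih =>
    rw [pow_succ', Module.End.mul_apply]
    rcases k with _ | k
    · rfl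
    · exact ih (by omega)

/-- The effect on coefficients of transport along `1 + φ ℏ ^ (n + 1)`. -/
theorem NDStar.exists_algConj_correction (s : NDStar K C) (n : ℕ) {φ : C →ₗ[K] C} (hφ : φ 1 = 0) :
    ∃ (s' : NDStar K C) (τ : ℕ → C →ₗ[K] C), IsNDGauge K C τ ∧ AlgConj K C s s' τ ∧
      (∀ k ≤ n, s'.β k = s.β k) ∧ (∀ k, 0 < k → k ≤ n → τ k = 0) ∧
      ∀ f g, s'.β (n + 1) f g = s.β (n + 1) f g + (f * φ g - φ (f * g) + φ f * g) := by
  let τ : ℕ → C →ₗ[K] C := fun k => if k = 0 then LinearMap.id else if k = n + 1 then φ else 0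
  have hτ0 : τ 0 = LinearMap.id := by simp [τ]
  have hτn : τ (n + 1) = φ := by simp [τ]
  have hτ (k : ℕ) (h0 : 0 < k) (hk : k ≤ n) : τ k = 0 := by
    simp [τ, h0.ne', show k ≠ n + 1 by omega]
  have hτg : IsNDGauge K C τ := by
    refine ⟨hτ0, fun k => ?_⟩
    rcases eq_or_ne k n with rfl | hk
    · simp [hτn, hφ]
    · simp [τ, hk]
  have hτc (f : C) : act τ (constSeries K C f) =
      constSeries K C f + (hbar K C ^ (n + 1)) (constSeries K C (φ f)) := by
    ext k
    rw [act_constSeries]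
    rcases lt_trichotomy k (n + 1) with hk | rfl | hk
    · rw [Pi.add_apply, hbar_pow_of_lt hk]
      rcases k with _ | k
      · simp [hτ0]
      · simp [hτ _ k.succ_pos (by omega)]
    · have := hbar_pow_add (K := K) (n + 1) 0 (constSeries K C (φ f))
      simp only [add_zero] at this
      simp [hτn, this]
    · obtain ⟨m, rfl⟩ := Nat.exists_eq_add_of_lt hk
      rw [Pi.add_apply, show n + 1 + m + 1 = n + 1 + (m + 1) by ring, hbar_pow_add]
      simp [τ]
      rfl
  have hact (x : ℕ → C) (k : ℕ) (hk : k ≤ n) : act τ x k = x k := by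
    rw [act_apply, Finset.sum_eq_single (0, k)]
    · simp [hτ0]
    · rintro ⟨i, j⟩ hij hne
      rw [mem_antidiagonal] at hij
      simp only at hij
      rcases i with _ | i
      · exact absurd (by simpa using hij) hne
      · simp [hτ (i + 1) i.succ_pos (by omega)]
    · simp
  have hact' (x : ℕ → C) : act τ x (n + 1) = x (n + 1) + φ (x 0) := by
    rw [act_apply, Finset.Nat.sum_antidiagonal_succ, Finset.sum_eq_single (n, 0)]
    · simp [hτ0, hτn]
    · rintro ⟨i, j⟩ hij hne
      rw [mem_antidiagonal] at hij
      simp only at hij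
      have : i ≠ n := by
        rintro rfl
        exact hne (by simpa using hij)
      simp [hτ (i + 1) i.succ_pos (by omega)]
    · simp
  obtain ⟨s', hs'⟩ := hτg.exists_algConj s
  have hl (m : ℕ) (x y : ℕ → C) :
      starMul s.β ((hbar K C ^ m) x) y = (hbar K C ^ m) (starMul s.β x y) := by
    induction m with
    | zero => simp
    | succ m ih => simp [pow_succ', ih]
  have hr (m : ℕ) (x y : ℕ → C) :
      starMul s.β x ((hbar K C ^ m) y) = (hbar K C ^ m) (starMul s.β x y) := by
    induction m with
    | zero => simp
    | succ m ih => simp [pow_succ', ih]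
  have key (f g : C) (k : ℕ) :=
    congr_fun (algConj_iff.1 hs' (constSeries K C f) (constSeries K C g)) k
  simp only [hτc, map_add, LinearMap.add_apply, hl, hr, starMul_constSeries, Pi.add_apply] at key
  refine ⟨s', τ, hτg, hs', fun k hk => ?_, hτ, fun f g => ?_⟩
  · ext f g
    have := key f g k
    rw [hact _ _ hk] at this
    simpa only [hbar_pow_of_lt (show k < n + 1 by omega), add_zero] using this
  · have := key f g (n + 1)
    have e (x : ℕ → C) : (hbar K C ^ (n + 1)) x (n + 1) = x 0 := hbar_pow_add (n + 1) 0 x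
    rw [hact', e, e, e, hbar_pow_of_lt n.succ_pos] at this
    simp only [s.β_zero, s'.β_zero, LinearMap.mul_apply_apply, add_zero] at this
    linear_combination this

end FormalSeries

section StarProducts
variable {K C}
open LinearMap
open Finset.HasAntidiagonal (antidiagonal mem_antidiagonal)

theorem exists_diffOps_bound {γ : ℕ → C →ₗ[K] C} {n : ℕ} (h : ∀ k < n, IsDiffOp K C (γ k)) :
    ∃ N, ∀ k < n, γ k ∈ diffOps K C N := by
  choose! N hN using h
  exact ⟨(Finset.range n).sup N, fun k hk =>
    diffOps_mono (Finset.le_sup (f := N) (Finset.mem_range.2 hk)) (hN k hk)⟩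

theorem exists_bidiff_bound {β : ℕ → C →ₗ[K] C →ₗ[K] C} {n : ℕ}
    (h : ∀ k < n, IsBiDiffOp K C (β k)) :
    ∃ N, ∀ k < n, (∀ g, (β k).flip g ∈ diffOps K C N) ∧ ∀ f, β k f ∈ diffOps K C N := by
  choose! N hN using h
  exact ⟨(Finset.range n).sup N, fun k hk =>
    have hle := diffOps_mono (K := K) (C := C) (Finset.le_sup (f := N) (Finset.mem_range.2 hk))
    ⟨fun g => hle ((hN k hk).1 g), fun f => hle ((hN k hk).2 f)⟩⟩

theorem NDStar.IsDifferential.isBiDiffOp {s : NDStar K C} (hs : s.IsDifferential) (n : ℕ) :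
    IsBiDiffOp K C (s.β n) := by
  rcases n with _ | n
  · rw [s.β_zero]
    refine ⟨0, fun g => ?_, fun f => mulLeft_mem_diffOps 0 f⟩
    convert! mulLeft_mem_diffOps (K := K) 0 g using 1
    ext f
    simp
  · exact hs n

/-- A bilinear map with bidifferential Hochschild coboundary is bidifferential up to the coboundary
of a linear map. -/
theorem exists_isBiDiffOp_add_coboundary [Algebra.Smooth K C] {M : ℕ} {β : C →ₗ[K] C →ₗ[K] C}
    (h₁ : ∀ g x, mulLeft K (β g x) - β.flip x ∘ₗ mulLeft K g + β.flip (g * x)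
      - mulLeft K x ∘ₗ β.flip g ∈ diffOps K C M)
    (h₂ : ∀ f g, mulLeft K f ∘ₗ β g - β (f * g) + β f ∘ₗ mulLeft K g - mulLeft K (β f g)
      ∈ diffOps K C M) :
    ∃ φ : C →ₗ[K] C, φ 1 = 0 ∧ ∀ β' : C →ₗ[K] C →ₗ[K] C,
      (∀ f g, β' f g = β f g + (f * φ g - φ (f * g) + φ f * g)) → IsBiDiffOp K C β' := by
  obtain ⟨φ₀, N, hφ₀⟩ := exists_sub_commutator_mem_diffOps β (M := M) fun f g => by
    convert! add_mem (h₂ f g) (mulLeft_mem_diffOps M (β f g)) using 1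
    abel
  refine ⟨φ₀ - mulLeft K (φ₀ 1), by simp, fun β' hβ' => ?_⟩
  have hr (f : C) : β' f ∈ diffOps K C N := by
    convert! add_mem (hφ₀ f) (mulLeft_mem_diffOps N ((φ₀ - mulLeft K (φ₀ 1)) f)) using 1
    ext g
    simp [hβ']
    ring
  refine ⟨M + N + 1, fun x => flip_mem_diffOps_of_coboundary hr (fun g x => ?_) x,
    fun f => diffOps_mono (show N ≤ M + N + 1 by omega) (hr f)⟩
  convert! h₁ g x using 1
  ext f
  have e₁ : f * (g * x) = g * f * x := by ring
  simp [hβ', e₁, mul_comm f g]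
  ring

/-- The Hochschild coboundary of the first non-bidifferential coefficient. -/
theorem NDStar.coboundary_eq (s : NDStar K C) (n : ℕ) (f g h : C) :
    f * s.β (n + 1) g h - s.β (n + 1) (f * g) h + s.β (n + 1) f (g * h) - s.β (n + 1) f g * h =
      ∑ i ∈ Finset.range n, (s.β (i + 1) (s.β (n - i) f g) h - s.β (i + 1) f (s.β (n - i) g h)) := by
  have := s.assoc (n + 1) f g h
  rw [Finset.sum_range_succ, Finset.sum_range_succ', Finset.sum_range_succ _ (n + 1),
    Finset.sum_range_succ' _ n] at this
  simp only [Nat.sub_self, Nat.sub_zero, s.β_zero, mul_apply_apply, Nat.add_sub_add_right] at this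
  rw [Finset.sum_sub_distrib]
  linear_combination -this

theorem NDStar.exists_correction [Algebra.Smooth K C] (s : NDStar K C) {n : ℕ}
    (hs : ∀ k < n, IsBiDiffOp K C (s.β (k + 1))) :
    ∃ φ : C →ₗ[K] C, φ 1 = 0 ∧ ∀ β' : C →ₗ[K] C →ₗ[K] C,
      (∀ f g, β' f g = s.β (n + 1) f g + (f * φ g - φ (f * g) + φ f * g)) →
        IsBiDiffOp K C β' := by
  obtain ⟨N, hN⟩ := exists_bidiff_bound hs
  have hN' (i : ℕ) (hi : i < n) : (∀ g, (s.β (n - i)).flip g ∈ diffOps K C N) ∧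
      ∀ f, s.β (n - i) f ∈ diffOps K C N := by
    simpa only [show n - i - 1 + 1 = n - i by omega] using hN (n - i - 1) (by omega)
  refine exists_isBiDiffOp_add_coboundary (M := N + N) (fun g x => ?_) fun f g => ?_
  · have : ∑ i ∈ Finset.range n, ((s.β (i + 1)).flip x ∘ₗ (s.β (n - i)).flip g -
        (s.β (i + 1)).flip (s.β (n - i) g x)) ∈ diffOps K C (N + N) :=
      sum_mem fun i hi => sub_mem
        (comp_mem_diffOps ((hN i (Finset.mem_range.1 hi)).1 x) ((hN' i (Finset.mem_range.1 hi)).1 g))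
        (diffOps_mono (Nat.le_add_left N N) ((hN i (Finset.mem_range.1 hi)).1 _))
    convert! this using 1
    ext f
    have e := s.coboundary_eq n f g x
    simp only [LinearMap.sub_apply, LinearMap.add_apply, LinearMap.comp_apply, mulLeft_apply,
      flip_apply, LinearMap.sum_apply]
    rw [← e, mul_comm g f]
    ring
  · have : ∑ i ∈ Finset.range n, (s.β (i + 1) (s.β (n - i) f g) -
        s.β (i + 1) f ∘ₗ s.β (n - i) g) ∈ diffOps K C (N + N) :=
      sum_mem fun i hi => sub_mem
        (diffOps_mono (Nat.le_add_left N N) ((hN i (Finset.mem_range.1 hi)).2 _))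
        (comp_mem_diffOps ((hN i (Finset.mem_range.1 hi)).2 f) ((hN' i (Finset.mem_range.1 hi)).2 g))
    convert! this using 1
    ext x
    simpa [LinearMap.sum_apply] using s.coboundary_eq n f g x

theorem seriesComp_eq_of_vanishing {γ τ : ℕ → C →ₗ[K] C} {n k : ℕ} (h0 : τ 0 = LinearMap.id)
    (hτ : ∀ j, 0 < j → j ≤ n → τ j = 0) (hk : k ≤ n) : seriesComp γ τ k = γ k := by
  rw [seriesComp, Finset.sum_eq_single (k, 0)]
  · simp [h0]
  · rintro ⟨i, j⟩ hij hne
    rw [mem_antidiagonal] at hij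
    simp only at hij
    rcases j with _ | j
    · exact absurd (by simpa using hij) hne
    · simp [hτ (j + 1) j.succ_pos (by omega)]
  · simp

/-- Every star product is gauge equivalent to a differential one. -/
theorem NDStar.exists_isDifferential [Algebra.Smooth K C] (s : NDStar K C) :
    ∃ s' : NDStar K C, s'.IsDifferential ∧ NDGaugeRel K C s s' := by
  let X (n : ℕ) : Type := {p : NDStar K C × (ℕ → C →ₗ[K] C) // IsNDGauge K C p.2 ∧
    AlgConj K C s p.1 p.2 ∧ ∀ k < n, IsBiDiffOp K C (p.1.β (k + 1))}
  have step (n : ℕ) (p : X n) :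
      ∃ q : X (n + 1), ∀ k ≤ n, q.1.1.β k = p.1.1.β k ∧ q.1.2 k = p.1.2 k := by
    obtain ⟨⟨s', γ⟩, hγ, hs', hd⟩ := p
    obtain ⟨φ, hφ1, hφ⟩ := s'.exists_correction hd
    obtain ⟨s'', τ, hτ, hs'', hβ, hτ0, hc⟩ := s'.exists_algConj_correction n hφ1
    refine ⟨⟨(s'', seriesComp γ τ), hγ.comp hτ, hs'.trans hs'', fun k hk => ?_⟩, fun k hk =>
      ⟨hβ k hk, seriesComp_eq_of_vanishing hτ.1 hτ0 hk⟩⟩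
    rcases Nat.lt_succ_iff_lt_or_eq.1 hk with hk | rfl
    · simpa only [hβ (k + 1) hk] using hd k hk
    · exact hφ _ hc
  choose next hnext using step
  obtain ⟨γ₀, hγ₀, hs₀⟩ := (ndGaugeRel_equivalence K C).refl s
  let u (n : ℕ) : X n := Nat.rec ⟨(s, γ₀), hγ₀, hs₀, fun k hk => absurd hk k.not_lt_zero⟩ next n
  have hu (n k : ℕ) (hk : k ≤ n) :
      (u n).1.1.β k = (u k).1.1.β k ∧ (u n).1.2 k = (u k).1.2 k := by
    induction n, hk using Nat.le_induction with
    | base => exact ⟨rfl, rfl⟩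
    | succ n hn ih => exact ⟨(hnext n (u n) k hn).1.trans ih.1, (hnext n (u n) k hn).2.trans ih.2⟩
  let s' : NDStar K C :=
    { β := fun k => (u k).1.1.β k
      β_zero := (u 0).1.1.β_zero
      norm_left := fun n g => (u (n + 1)).1.1.norm_left n g
      norm_right := fun n f => (u (n + 1)).1.1.norm_right n f
      assoc := fun n f g h => by
        convert (u n).1.1.assoc n f g h using 2 with p hp p hp <;>
        · rw [(hu n p (by simpa [Nat.lt_succ_iff] using hp)).1, (hu n (n - p) (by omega)).1] }
  refine ⟨s', fun n => (u (n + 1)).2.2.2 n n.lt_succ_self, fun k => (u k).1.2 k,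
    ⟨(u 0).2.1.1, fun n => (u (n + 1)).2.1.2 n⟩, ?_⟩
  refine algConj_iff_antidiagonal.2 fun n f g => ?_
  convert algConj_iff_antidiagonal.1 (u n).2.2.1 n f g using 2 with a ha a ha
  · rw [mem_antidiagonal] at ha
    change ((u a.1).1.2 a.1) ((u a.2).1.1.β a.2 f g) = _
    rw [(hu n a.1 (by omega)).2, (hu n a.2 (by omega)).1]
  · rw [mem_antidiagonal] at ha
    refine Finset.sum_congr rfl fun b hb => ?_
    rw [mem_antidiagonal] at hb
    rw [(hu n b.1 (by omega)).2, (hu n b.2 (by omega)).2]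

/-- A gauge equivalence between differential star products is differential. -/
theorem AlgConj.isDiffOp {s s' : NDStar K C} (hs : s.IsDifferential) (hs' : s'.IsDifferential)
    {γ : ℕ → C →ₗ[K] C} (hγ : IsNDGauge K C γ) (h : AlgConj K C s s' γ) (n : ℕ) :
    IsDiffOp K C (γ n) := by
  induction n using Nat.strong_induction_on with
  | _ n ih =>
    rcases n with _ | n
    · rw [hγ.1]
      exact ⟨0, fun c x => rfl⟩
    obtain ⟨N₁, hN₁⟩ := exists_bidiff_bound (n := n + 2) fun k _ => hs.isBiDiffOp k
    obtain ⟨N₂, hN₂⟩ := exists_bidiff_bound (n := n + 2) fun k _ => hs'.isBiDiffOp k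
    obtain ⟨N₃, hN₃⟩ := exists_diffOps_bound ih
    let N := N₁ + N₂ + N₃
    have mem₁ {k : ℕ} (hk : k < n + 2) (f : C) : s.β k f ∈ diffOps K C N :=
      diffOps_mono (by omega) ((hN₁ k hk).2 f)
    have mem₂ {k : ℕ} (hk : k < n + 2) (f : C) : s'.β k f ∈ diffOps K C N :=
      diffOps_mono (by omega) ((hN₂ k hk).2 f)
    have mem₃ {k : ℕ} (hk : k < n + 1) : γ k ∈ diffOps K C N :=
      diffOps_mono (by omega) (hN₃ k hk)
    refine ⟨N + N + 1, fun f => ?_⟩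
    have h₁ : ∑ a ∈ antidiagonal n,
        ∑ b ∈ antidiagonal a.2, s.β (a.1 + 1) (γ b.1 f) ∘ₗ γ b.2 ∈
          diffOps K C (N + N) := by
      refine sum_mem fun a ha => sum_mem fun b hb => ?_
      rw [mem_antidiagonal] at ha hb
      exact comp_mem_diffOps (mem₁ (by omega) _) (mem₃ (by omega))
    have h₂ : ∑ b ∈ antidiagonal n,
        s.β 0 (γ (b.1 + 1) f) ∘ₗ γ b.2 ∈ diffOps K C (N + N) := by
      refine sum_mem fun b hb => ?_
      rw [mem_antidiagonal] at hb
      exact comp_mem_diffOps (mem₁ (by omega) _) (mem₃ (by omega))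
    have h₃ : ∑ a ∈ antidiagonal n, γ a.1 ∘ₗ s'.β (a.2 + 1) f ∈
        diffOps K C (N + N) := by
      refine sum_mem fun a ha => ?_
      rw [mem_antidiagonal] at ha
      exact comp_mem_diffOps (mem₃ (by omega)) (mem₂ (by omega) _)
    rw [← mem_diffOps]
    convert! sub_mem (add_mem h₂ h₁) h₃ using 1
    ext g
    have key := algConj_iff_antidiagonal.1 h (n + 1) f g
    rw [Finset.Nat.sum_antidiagonal_succ', Finset.Nat.sum_antidiagonal_succ,
      Finset.Nat.sum_antidiagonal_succ] at key
    simp only [s.β_zero, s'.β_zero, mul_apply_apply, hγ.1, LinearMap.id_apply] at key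
    simp only [LinearMap.sub_apply, LinearMap.add_apply, LinearMap.comp_apply, mulLeft_apply,
      LinearMap.sum_apply, s.β_zero, mul_apply_apply]
    linear_combination key

end StarProducts

/-- Proposition 9.5 of the paper.  Let `K ⊇ ℝ` and `C` a smooth
`K`-algebra.  The obvious map from {star products on `C[[ℏ]]`} / gauge equivalence to
{non-differential star products on `C[[ℏ]]`} / non-differential gauge equivalence is
bijective. -/
theorem differential_vs_nondifferential_star_products
    [CharZero K] (ρ : ℝ →+* K) [Algebra.Smooth K C] :
    ∃ Φ : Quot (DGaugeRel K C) → Quot (NDGaugeRel K C),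
      (∀ s : {s : NDStar K C // s.IsDifferential}, Φ (Quot.mk _ s) = Quot.mk _ s.1) ∧
      Function.Bijective Φ := by
  refine ⟨Quot.map Subtype.val fun _ _ ⟨γ, hγ, _, h⟩ => ⟨γ, hγ, h⟩, fun _ => rfl, ?_, ?_⟩
  · rintro ⟨s⟩ ⟨s'⟩ h
    obtain ⟨γ, hγ, h⟩ := (ndGaugeRel_equivalence K C).eqvGen_iff.1 (Quot.eqvGen_exact h)
    exact Quot.sound ⟨γ, hγ, fun n => h.isDiffOp s.2 s'.2 hγ (n + 1), h⟩
  · rintro ⟨s⟩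
    obtain ⟨s', hs', h⟩ := s.exists_isDifferential
    exact ⟨Quot.mk _ ⟨s', hs'⟩, (Quot.sound h).symm⟩

end Statement19
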